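/- Suppose G = H₁ *_M H₂ is an amalgamated free product of two free groups H₁, H₂ each of rank 2 over a subgroup M, and G surjects onto the free group F₃ of rank 3. Then M is cyclic (possibly trivial). -/

import Mathlib

set_option linter.unusedSectionVars false

namespace Stmt10

section MN

variable {Γ : Type*} [Group Γ] [LinearOrder Γ] [MulLeftMono Γ] [MulRightMono Γ]

theorem antidiag_finite {s t : Set Γ} (hs : s.IsPWO) (ht : t.IsPWO) (h : Γ) :
    {a : Γ | a ∈ s ∧ a⁻¹ * h ∈ t}.Finite := by
  by_contra hinf
  have hinf : Set.Infinite {a : Γ | a ∈ s ∧ a⁻¹ * h ∈ t} := hinf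
  let u : ℕ → Γ := fun n => (hinf.natEmbedding _ n : Γ)
  have hu : ∀ n, u n ∈ s ∧ (u n)⁻¹ * h ∈ t := fun n => (hinf.natEmbedding _ n).2
  have huinj : Function.Injective u := fun m n hmn =>
    (hinf.natEmbedding _).injective (Subtype.ext hmn)
  obtain ⟨g, hg⟩ := hs.exists_monotone_subseq (f := u) (fun n => (hu n).1)
  obtain ⟨g', hg'⟩ := ht.exists_monotone_subseq (f := fun n => (u (g n))⁻¹ * h)
    (fun n => (hu (g n)).2)
  have h1 : u (g (g' 0)) ≤ u (g (g' 1)) := hg (g'.monotone (by norm_num))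
  have h2 : (u (g (g' 0)))⁻¹ * h ≤ (u (g (g' 1)))⁻¹ * h := hg' (by norm_num : (0 : ℕ) ≤ 1)
  have h3 : u (g (g' 1)) ≤ u (g (g' 0)) :=
    inv_le_inv_iff.mp (le_of_mul_le_mul_right' h2)
  have h4 := huinj (le_antisymm h1 h3)
  have h5 := g'.injective (g.injective h4)
  omega

theorem isPWO_mul {s t : Set Γ} (hs : s.IsPWO) (ht : t.IsPWO) :
    {c : Γ | ∃ a ∈ s, ∃ b ∈ t, a * b = c}.IsPWO := by
  have : {c : Γ | ∃ a ∈ s, ∃ b ∈ t, a * b = c} = (fun p : Γ × Γ => p.1 * p.2) '' (s ×ˢ t) := by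
    ext c
    simp only [Set.mem_ofPred_eq, Set.mem_image, Set.mem_prod, Prod.exists]
    constructor
    · rintro ⟨a, ha, b, hb, rfl⟩; exact ⟨a, b, ⟨ha, hb⟩, rfl⟩
    · rintro ⟨a, b, ⟨ha, hb⟩, rfl⟩; exact ⟨a, ha, b, hb, rfl⟩
  rw [this]
  exact (hs.prod ht).image_of_monotone (fun p q hpq => mul_le_mul' hpq.1 hpq.2)

theorem prod_le_of_sublistForall {l₁ l₂ : List Γ} (h : List.SublistForall₂ (· ≤ ·) l₁ l₂)
    (hpos : ∀ x ∈ l₂, 1 ≤ x) : l₁.prod ≤ l₂.prod := by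
  induction h with
  | nil => 
    rw [List.prod_nil]
    exact List.one_le_prod_of_one_le hpos
  | cons hab _ ih =>
    rw [List.prod_cons, List.prod_cons]
    exact mul_le_mul' hab (ih fun x hx => hpos x (List.mem_cons_of_mem _ hx))
  | cons_right _ ih =>
    rw [List.prod_cons]
    exact (ih fun x hx => hpos x (List.mem_cons_of_mem _ hx)).trans
      (le_mul_of_one_le_left' (hpos _ (List.mem_cons_self ..)))

theorem isPWO_closure {s : Set Γ} (hs : s.IsPWO) (hpos : ∀ x ∈ s, 1 ≤ x) :
    (Submonoid.closure s : Set Γ).IsPWO := by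
  rw [Submonoid.closure_eq_image_prod]
  refine (hs.partiallyWellOrderedOn_sublistForall₂ (· ≤ ·)).image_of_monotone_on ?_
  exact fun l1 _ l2 hl2 h12 => prod_le_of_sublistForall h12 fun x hx => hpos x (hl2 x hx)

variable (Γ) in
/-- Malcev–Neumann series: functions with well-ordered support. -/
@[ext] structure MN where
  coeff : Γ → ℚ
  pwo' : (Function.support coeff).IsPWO

namespace MN

instance : CoeFun (MN Γ) (fun _ => Γ → ℚ) := ⟨MN.coeff⟩

theorem pwo (f : MN Γ) : (Function.support f).IsPWO := f.pwo'

theorem ext' {f g : MN Γ} (h : ∀ a, f a = g a) : f = g := MN.ext (funext h)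

instance : Zero (MN Γ) := ⟨⟨fun _ => 0, by simp⟩⟩
instance : Add (MN Γ) := ⟨fun f g => ⟨fun a => f a + g a,
  (f.pwo.union g.pwo).mono (Function.support_add f g)⟩⟩
instance : Neg (MN Γ) := ⟨fun f => ⟨fun a => - f a, by
  have := f.pwo
  refine this.mono ?_
  intro a ha h
  exact ha (by simp [h])⟩⟩

@[simp] theorem add_apply (f g : MN Γ) (a : Γ) : (f + g) a = f a + g a := rfl
@[simp] theorem neg_apply (f : MN Γ) (a : Γ) : (-f) a = - f a := rfl
@[simp] theorem zero_apply (a : Γ) : (0 : MN Γ) a = 0 := rfl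

noncomputable instance instAddCommGroup : AddCommGroup (MN Γ) where
  add_assoc f g h := ext' fun a => by simp [add_assoc]
  zero_add f := ext' fun a => by simp
  add_zero f := ext' fun a => by simp
  add_comm f g := ext' fun a => by simp [add_comm]
  neg_add_cancel f := ext' fun a => by simp
  nsmul := nsmulRec
  zsmul := zsmulRec

@[simp] theorem sub_apply (f g : MN Γ) (a : Γ) : (f - g) a = f a - g a := by
  rw [sub_eq_add_neg, sub_eq_add_neg]; rfl

theorem conv_finite (f g : MN Γ) (h : Γ) :
    Function.HasFiniteSupport (fun a => f a * g (a⁻¹ * h)) := by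
  refine (antidiag_finite f.pwo g.pwo h).subset ?_
  intro a ha
  simp only [Function.mem_support] at ha ⊢
  exact ⟨left_ne_zero_of_mul ha, right_ne_zero_of_mul ha⟩

noncomputable instance : Mul (MN Γ) := ⟨fun f g =>
  ⟨fun h => ∑ᶠ a, f a * g (a⁻¹ * h), by
    refine (isPWO_mul f.pwo g.pwo).mono ?_
    intro h hh
    obtain ⟨a, ha⟩ : ∃ a, f a * g (a⁻¹ * h) ≠ 0 := by
      by_contra hcon
      push Not at hcon
      exact hh (finsum_eq_zero_of_forall_eq_zero hcon)
    exact ⟨a, left_ne_zero_of_mul ha, a⁻¹ * h, right_ne_zero_of_mul ha, by group⟩⟩⟩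

theorem mul_apply (f g : MN Γ) (h : Γ) : (f * g) h = ∑ᶠ a, f a * g (a⁻¹ * h) := rfl

open Classical in
/-- Monomials. -/
noncomputable def single (g : Γ) (q : ℚ) : MN Γ := ⟨fun h => if h = g then q else 0, by
  refine (Set.isPWO_singleton g).mono ?_
  intro h hh
  by_contra hne
  exact hh (if_neg hne)⟩

open Classical in
theorem single_apply (g : Γ) (q : ℚ) (h : Γ) : single g q h = if h = g then q else 0 := rfl

theorem single_mul_apply (g : Γ) (q : ℚ) (f : MN Γ) (h : Γ) :
    (single g q * f) h = q * f (g⁻¹ * h) := by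
  rw [mul_apply, finsum_eq_single _ g]
  · simp [single_apply]
  · intro a ha; simp [single_apply, ha]

theorem mul_single_apply (g : Γ) (q : ℚ) (f : MN Γ) (h : Γ) :
    (f * single g q) h = f (h * g⁻¹) * q := by
  rw [mul_apply, finsum_eq_single _ (h * g⁻¹)]
  · simp [single_apply]
  · intro a ha
    have : a⁻¹ * h ≠ g := by
      rintro rfl; apply ha; group
    simp [single_apply, this]

noncomputable instance : One (MN Γ) := ⟨single 1 1⟩

theorem one_def : (1 : MN Γ) = single 1 1 := rfl

protected theorem mul_assoc (f g e : MN Γ) : f * g * e = f * (g * e) := by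
  refine ext' fun h => ?_
  simp only [mul_apply]
  have hfin : Function.HasFiniteSupport
      (fun p : Γ × Γ => f p.1 * g (p.1⁻¹ * p.2) * e (p.2⁻¹ * h)) := by
    have h1 := antidiag_finite (isPWO_mul f.pwo g.pwo) e.pwo h
    refine (h1.biUnion (t := fun c => (fun a => (a, c)) '' {a | a ∈ Function.support f ∧
      a⁻¹ * c ∈ Function.support g}) (fun c _ =>
        (antidiag_finite f.pwo g.pwo c).image _)).subset ?_
    rintro ⟨a, c⟩ hac
    have hac : f a * g (a⁻¹ * c) * e (c⁻¹ * h) ≠ 0 := hac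
    simp only [Set.mem_iUnion, Set.mem_image]
    have hf := left_ne_zero_of_mul (left_ne_zero_of_mul hac)
    have hg := right_ne_zero_of_mul (left_ne_zero_of_mul hac)
    exact ⟨c, ⟨⟨a, hf, a⁻¹ * c, hg, by group⟩, right_ne_zero_of_mul hac⟩, a, ⟨hf, hg⟩, rfl⟩
  have hfin' : Function.HasFiniteSupport
      (fun p : Γ × Γ => f p.2 * g (p.2⁻¹ * p.1) * e (p.1⁻¹ * h)) := by
    have := hfin.image (Equiv.prodComm Γ Γ)
    refine this.subset ?_
    rintro ⟨a, c⟩ hac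
    exact ⟨(c, a), hac, rfl⟩
  have e1 := finsum_curry _ hfin
  have e2 := finsum_curry _ hfin'
  have e3 := finsum_comp_equiv (Equiv.prodComm Γ Γ)
    (f := (fun p : Γ × Γ => f p.1 * g (p.1⁻¹ * p.2) * e (p.2⁻¹ * h)))
  simp only [Equiv.prodComm_apply, Prod.fst_swap, Prod.snd_swap] at e3
  calc _ = ∑ᶠ c, ∑ᶠ a, f a * g (a⁻¹ * c) * e (c⁻¹ * h) := by
        refine finsum_congr fun c => ?_
        rw [finsum_mul]
    _ = ∑ᶠ a, ∑ᶠ c, f a * g (a⁻¹ * c) * e (c⁻¹ * h) := by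
        rw [← e1, ← e2, e3]
    _ = _ := by
        refine finsum_congr fun a => ?_
        rw [mul_finsum, ← finsum_comp_equiv (Equiv.mulLeft a)]
        refine finsum_congr fun b => ?_
        simp [mul_assoc]

noncomputable instance instRing : Ring (MN Γ) :=
  { instAddCommGroup with
    mul := (· * ·)
    one := 1
    mul_assoc := MN.mul_assoc
    one_mul := fun f => by refine ext' fun h => ?_; simp [one_def, single_mul_apply]
    mul_one := fun f => by refine ext' fun h => ?_; simp [one_def, mul_single_apply]
    zero_mul := fun f => by refine ext' fun h => ?_; simp [mul_apply]
    mul_zero := fun f => by refine ext' fun h => ?_; simp [mul_apply]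
    left_distrib := fun f g e => by
      refine ext' fun h => ?_
      simp only [mul_apply, add_apply, mul_add]
      exact finsum_add_distrib (conv_finite f g h) (conv_finite f e h)
    right_distrib := fun f g e => by
      refine ext' fun h => ?_
      simp only [mul_apply, add_apply, add_mul]
      exact finsum_add_distrib (conv_finite f e h) (conv_finite g e h) }

theorem exists_right_inv (f : MN Γ) (hf : f ≠ 0) : ∃ v : MN Γ, f * v = 1 := by
  classical
  have hne : (Function.support f).Nonempty := by
    by_contra h
    apply hf
    refine ext' fun a => ?_
    by_contra h'
    exact h ⟨a, h'⟩
  set g0 := f.pwo.isWF.min hne with hg0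
  have hg0s : f g0 ≠ 0 := f.pwo.isWF.min_mem hne
  have hg0le : ∀ a, f a ≠ 0 → g0 ≤ a := fun a ha => f.pwo.isWF.min_le hne ha
  let P : Set Γ := (fun a => g0⁻¹ * a) '' Function.support f
  have hP : P.IsPWO := f.pwo.image_of_monotone (fun a b hab => mul_le_mul_right hab _)
  have hP1 : ∀ x ∈ P, 1 ≤ x := by
    rintro _ ⟨a, ha, rfl⟩
    have := hg0le a ha
    simpa using this
  let W : Set Γ := (fun w => w * g0⁻¹) '' (Submonoid.closure P : Set Γ)
  have hW : W.IsPWO := (isPWO_closure hP hP1).image_of_monotone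
    (fun a b hab => mul_le_mul_left hab _)
  have hW1 : g0⁻¹ ∈ W := ⟨1, Submonoid.one_mem _, by simp⟩
  have hWstep : ∀ a h, f a ≠ 0 → a⁻¹ * g0 * h ∈ W → h ∈ W := by
    rintro a h ha ⟨w, hw, hwe⟩
    refine ⟨g0⁻¹ * a * w, Submonoid.mul_mem _ (Submonoid.subset_closure ⟨a, ha, rfl⟩) hw, ?_⟩
    have hwe : w * g0⁻¹ = a⁻¹ * g0 * h := hwe
    change g0⁻¹ * a * w * g0⁻¹ = h
    rw [mul_assoc _ w, hwe]; group
  have hwf : WellFounded (fun a b : W => (a : Γ) < b) := by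
    have := hW.isWF
    exact this
  -- recursion
  let step : ∀ h : W, (∀ h' : W, (h' : Γ) < h → ℚ) → ℚ := fun h rec =>
    (f g0)⁻¹ * ((if g0 * (h : Γ) = 1 then 1 else 0) -
      ∑ᶠ a, if hh : a⁻¹ * g0 * h ∈ W ∧ a⁻¹ * g0 * h < h then f a * rec ⟨_, hh.1⟩ hh.2 else 0)
  let v0 : W → ℚ := hwf.fix step
  have hv0 : ∀ h : W, v0 h = step h (fun h' _ => v0 h') := fun h => hwf.fix_eq step h
  let v : Γ → ℚ := fun h => if hh : h ∈ W then v0 ⟨h, hh⟩ else 0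
  have hvW : ∀ h, h ∉ W → v h = 0 := fun h hh => dif_neg hh
  let V : MN Γ := ⟨v, hW.mono (fun h hh => by
    by_contra h'
    exact hh (hvW h h'))⟩
  refine ⟨V, ?_⟩
  have key : ∀ h, (f * V) (g0 * h) = if g0 * h = 1 then 1 else 0 := by
    intro h
    rw [mul_apply]
    by_cases hh : h ∈ W
    · have hval : v h = (f g0)⁻¹ * ((if g0 * (h : Γ) = 1 then 1 else 0) -
          ∑ᶠ a, if a = g0 then 0 else f a * v (a⁻¹ * (g0 * h))) := by
        have : v h = v0 ⟨h, hh⟩ := dif_pos hh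
        rw [this, hv0]
        simp only [step]
        congr 2
        refine finsum_congr fun a => ?_
        by_cases ha : a = g0
        · subst ha; simp
        · rw [if_neg ha]
          by_cases hfa : f a = 0
          · simp [hfa]
          · have hlt : a⁻¹ * g0 * h < h := by
              have h1 : g0 < a := lt_of_le_of_ne (hg0le a hfa) (Ne.symm ha)
              refine mul_lt_of_lt_one_left' _ ?_
              rwa [inv_mul_lt_iff_lt_mul, mul_one]
            by_cases hm : a⁻¹ * g0 * h ∈ W
            · rw [dif_pos ⟨hm, hlt⟩]
              have : v (a⁻¹ * (g0 * h)) = v0 ⟨a⁻¹ * g0 * h, hm⟩ := by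
                rw [← mul_assoc]; exact dif_pos hm
              rw [this]
            · rw [dif_neg (fun h' => hm h'.1), ← mul_assoc, hvW _ hm, mul_zero]
      have hsplit : ∑ᶠ a, f a * V (a⁻¹ * (g0 * h)) = f g0 * v h +
          ∑ᶠ a, if a = g0 then 0 else f a * v (a⁻¹ * (g0 * h)) := by
        have h1 : ∀ a, f a * V (a⁻¹ * (g0 * h)) = (if a = g0 then f g0 * v h else 0) +
            (if a = g0 then 0 else f a * v (a⁻¹ * (g0 * h))) := by
          intro a
          by_cases ha : a = g0
          · subst ha; simp [V]
          · simp [ha, V]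
        rw [finsum_congr h1, finsum_add_distrib, finsum_eq_single _ g0]
        · simp
        · intro a ha; simp [ha]
        · refine (Set.finite_singleton g0).subset ?_
          intro a ha
          by_contra h'
          exact ha (if_neg h')
        · refine (conv_finite f V (g0 * h)).subset ?_
          intro a ha
          by_cases h' : a = g0
          · exact absurd (if_pos h') ha
          · simpa [h', V] using ha
      rw [hsplit, hval]
      field_simp
      ring
    · have h1 : g0 * h ≠ 1 := by
        intro h'
        apply hh
        rwa [← eq_inv_of_mul_eq_one_right h'] at hW1
      rw [if_neg h1, finsum_eq_zero_of_forall_eq_zero]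
      intro a
      by_cases hfa : f a = 0
      · simp [hfa]
      · have : V (a⁻¹ * (g0 * h)) = 0 := by
          rw [← mul_assoc]
          exact hvW _ (fun h' => hh (hWstep a h hfa h'))
        rw [this, mul_zero]
  refine ext' fun h => ?_
  have := key (g0⁻¹ * h)
  simpa [one_def, single_apply] using this

instance : Nontrivial (MN Γ) := ⟨⟨0, 1, fun h => by
  have := congrArg (fun f : MN Γ => f 1) h
  simp [one_def, single_apply] at this⟩⟩

open Classical in
noncomputable instance : DivisionRing (MN Γ) :=
  { instRing with
    inv := fun f => if h : f = 0 then 0 else (exists_right_inv f h).choose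
    mul_inv_cancel := fun f hf => by
      change f * (if h : f = 0 then 0 else (exists_right_inv f h).choose) = 1
      rw [dif_neg hf]; exact (exists_right_inv f hf).choose_spec
    inv_zero := dif_pos rfl
    exists_pair_ne := exists_pair_ne _
    nnqsmul := _
    nnqsmul_def := fun _ _ => rfl
    qsmul := _
    qsmul_def := fun _ _ => rfl }

/-- group elements in the division ring. -/
noncomputable def emb : Γ →* MN Γ where
  toFun g := single g 1
  map_one' := rfl
  map_mul' g h := by
    refine ext' fun a => ?_
    rw [single_mul_apply, one_mul]
    simp only [single_apply]
    have : a = g * h ↔ g⁻¹ * a = h := by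
      constructor
      · rintro rfl; group
      · rintro rfl; group
    simp [this]

theorem emb_mul_apply (g : Γ) (f : MN Γ) (h : Γ) : (emb g * f) h = f (g⁻¹ * h) := by
  change (single g 1 * f) h = _
  rw [single_mul_apply, one_mul]

theorem mul_emb_apply (g : Γ) (f : MN Γ) (h : Γ) : (f * emb g) h = f (h * g⁻¹) := by
  change (f * single g 1) h = _
  rw [mul_single_apply, mul_one]

theorem emb_injective : Function.Injective (emb : Γ → MN Γ) := by
  intro a b hab
  by_contra h
  have := congrArg (fun f : MN Γ => f a) hab
  change single a 1 a = single b 1 a at this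
  simp [single_apply, h] at this

end MN

end MN

end Stmt10


set_option linter.unusedSectionVars false

namespace Stmt10

section Fin

variable {Γ : Type*} [Group Γ] [LinearOrder Γ] [MulLeftMono Γ] [MulRightMono Γ]

theorem cover_of_pos {v : Γ → ℚ} (hv : (Function.support v).IsPWO) {x : Γ} (hx : 1 < x)
    (h : {h | v (h * x⁻¹) ≠ v h}.Finite) :
    ∃ E : Set Γ, E.Finite ∧ ∀ h ∈ Function.support v, ∃ e ∈ E, ∃ n : ℤ, h = e * x ^ n := by
  refine ⟨_, h, ?_⟩
  intro a ha
  refine hv.isWF.induction (P := fun a => ∃ e ∈ {h | v (h * x⁻¹) ≠ v h}, ∃ n : ℤ, a = e * x ^ n)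
    ha ?_
  · intro a ha ih
    by_cases hE : v (a * x⁻¹) ≠ v a
    · exact ⟨a, hE, 0, by simp⟩
    · push Not at hE
      have h1 : a * x⁻¹ ∈ Function.support v := by
        change v (a * x⁻¹) ≠ 0
        rw [hE]; exact ha
      obtain ⟨e, he, n, hn⟩ := ih (a * x⁻¹) h1 (mul_lt_of_lt_one_right' _ (by simpa using hx))
      refine ⟨e, he, n + 1, ?_⟩
      rw [zpow_add_one, ← mul_assoc, ← hn]; group

theorem cover_of_ne {v : Γ → ℚ} (hv : (Function.support v).IsPWO) {x : Γ} (hx : x ≠ 1)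
    (h : {h | v (h * x⁻¹) ≠ v h}.Finite) :
    ∃ E : Set Γ, E.Finite ∧ ∀ h ∈ Function.support v, ∃ e ∈ E, ∃ n : ℤ, h = e * x ^ n := by
  rcases lt_or_gt_of_ne hx with h1 | h1
  · have h2 : {h | v (h * x⁻¹⁻¹) ≠ v h}.Finite := by
      refine (h.image (fun a => a * x⁻¹)).subset ?_
      intro a ha
      refine ⟨a * x, ?_, by group⟩
      change v (a * x * x⁻¹) ≠ v (a * x)
      rw [mul_inv_cancel_right]
      have ha : v (a * x⁻¹⁻¹) ≠ v a := ha
      rw [inv_inv] at ha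
      exact ha.symm
    obtain ⟨E, hE, hE'⟩ := cover_of_pos hv (x := x⁻¹) (by simpa using h1) h2
    refine ⟨E, hE, fun a ha => ?_⟩
    obtain ⟨e, he, n, rfl⟩ := hE' a ha
    exact ⟨e, he, -n, by simp⟩
  · exact cover_of_pos hv h1 h

theorem commute_of_zpow {x y : Γ} {k : ℤ} (hk : k ≠ 0) (h : Commute (x ^ k) y) : Commute x y := by
  have h1 : (y * x * y⁻¹) ^ k = x ^ k := by
    rw [conj_zpow, ← h.eq]; group
  have h2 : y * x * y⁻¹ = x := zpow_left_injective hk h1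
  have h3 : y * x = x * y := by
    rw [← mul_inv_eq_iff_eq_mul]; exact h2
  exact h3.symm

theorem support_finite {v : Γ → ℚ} (hv : (Function.support v).IsPWO) {x y : Γ}
    (hxy : ¬ Commute x y)
    (hx : {h | v (h * x⁻¹) ≠ v h}.Finite) (hy : {h | v (h * y⁻¹) ≠ v h}.Finite) :
    (Function.support v).Finite := by
  have hx1 : x ≠ 1 := by rintro rfl; exact hxy (Commute.one_left _)
  have hy1 : y ≠ 1 := by rintro rfl; exact hxy (Commute.one_right _)
  obtain ⟨E, hE, hE'⟩ := cover_of_ne hv hx1 hx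
  obtain ⟨F, hF, hF'⟩ := cover_of_ne hv hy1 hy
  have hsub : Function.support v ⊆ ⋃ p ∈ E ×ˢ F,
      {h | (∃ n : ℤ, h = p.1 * x ^ n) ∧ ∃ n : ℤ, h = p.2 * y ^ n} := by
    intro a ha
    obtain ⟨e, he, hn⟩ := hE' a ha
    obtain ⟨f, hf, hm⟩ := hF' a ha
    exact Set.mem_biUnion (x := (e, f)) ⟨he, hf⟩ ⟨hn, hm⟩
  refine ((hE.prod hF).biUnion fun p _ => Set.Subsingleton.finite ?_).subset hsub
  rintro a ⟨⟨n, hn⟩, m, hm⟩ b ⟨⟨n', hn'⟩, m', hm'⟩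
  by_contra hab
  have hne : n - n' ≠ 0 := by
    intro h0
    apply hab
    rw [hn, hn', sub_eq_zero.mp h0]
  apply hxy
  apply commute_of_zpow hne
  have e1 : b⁻¹ * a = x ^ (n - n') := by
    rw [hn, hn', sub_eq_neg_add, zpow_add, zpow_neg]; group
  have e2 : b⁻¹ * a = y ^ (m - m') := by
    rw [hm, hm', sub_eq_neg_add, zpow_add, zpow_neg]; group
  rw [← e1, e2]
  exact (Commute.refl y).zpow_left _

theorem MN.support_finite (v : MN Γ) {x y : Γ} (hxy : ¬ Commute x y)
    (hx : (Function.support (v * (MN.emb x - 1)).coeff).Finite)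
    (hy : (Function.support (v * (MN.emb y - 1)).coeff).Finite) :
    (Function.support v).Finite := by
  refine Stmt10.support_finite v.pwo hxy (hx.subset ?_) (hy.subset ?_) <;>
  · intro h hh
    have hh : v _ ≠ v h := hh
    rw [Function.mem_support, mul_sub, mul_one, MN.sub_apply, MN.mul_emb_apply]
    exact sub_ne_zero.mpr hh

end Fin

end Stmt10


set_option linter.unusedSectionVars false

namespace Stmt10

section Der

variable {D : Type*} [DivisionRing D]

/-- Crossed homomorphisms, as a left vector space. -/
def Der {G : Type*} [Group G] (θ : G →* D) : Submodule D (G → D) where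
  carrier := {δ | ∀ g h, δ (g * h) = δ g * θ h + δ h}
  zero_mem' := by intro g h; simp
  add_mem' := by
    intro a b ha hb g h
    simp only [Pi.add_apply, ha g h, hb g h, add_mul]
    abel
  smul_mem' := by
    intro c a ha g h
    simp only [Pi.smul_apply, smul_eq_mul, ha g h, mul_add, mul_assoc]

theorem Der.map_mul {G : Type*} [Group G] {θ : G →* D} (δ : Der θ) (g h : G) :
    δ.1 (g * h) = δ.1 g * θ h + δ.1 h := δ.2 g h

theorem Der.map_one {G : Type*} [Group G] {θ : G →* D} (δ : Der θ) : δ.1 1 = 0 := by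
  have := Der.map_mul δ 1 1
  simpa using this

theorem Der.map_inv {G : Type*} [Group G] {θ : G →* D} (δ : Der θ) (g : G) :
    δ.1 g⁻¹ = - (δ.1 g * θ g⁻¹) := by
  have := Der.map_mul δ g g⁻¹
  rw [mul_inv_cancel, Der.map_one] at this
  exact eq_neg_of_add_eq_zero_right this.symm

/-- kernel subgroup -/
def Der.ker {G : Type*} [Group G] {θ : G →* D} (δ : Der θ) : Subgroup G where
  carrier := {g | δ.1 g = 0}
  one_mem' := Der.map_one δ
  mul_mem' := by
    intro a b ha hb
    have ha : δ.1 a = 0 := ha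
    have hb : δ.1 b = 0 := hb
    change δ.1 (a * b) = 0
    rw [Der.map_mul, ha, hb]; simp
  inv_mem' := by
    intro a ha
    have ha : δ.1 a = 0 := ha
    change δ.1 a⁻¹ = 0
    rw [Der.map_inv, ha]; simp

variable (D) in
/-- Affine maps. -/
@[ext] structure Aff where
  u : Dˣ
  d : D

namespace Aff

instance : Mul (Aff D) := ⟨fun a b => ⟨a.u * b.u, a.d * b.u + b.d⟩⟩
instance : One (Aff D) := ⟨⟨1, 0⟩⟩
instance : Inv (Aff D) := ⟨fun a => ⟨a.u⁻¹, - (a.d * (a.u⁻¹ : Dˣ))⟩⟩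

theorem mul_u (a b : Aff D) : (a * b).u = a.u * b.u := rfl
theorem mul_d (a b : Aff D) : (a * b).d = a.d * b.u + b.d := rfl
theorem one_u : (1 : Aff D).u = 1 := rfl
theorem one_d : (1 : Aff D).d = 0 := rfl
theorem inv_u (a : Aff D) : (a⁻¹).u = a.u⁻¹ := rfl
theorem inv_d (a : Aff D) : (a⁻¹).d = - (a.d * (a.u⁻¹ : Dˣ)) := rfl

instance : Group (Aff D) := Group.ofLeftAxioms
  (by intro a b c; ext <;> simp [mul_u, mul_d, mul_assoc, add_mul, add_assoc])
  (by intro a; ext <;> simp [mul_u, mul_d, one_u, one_d])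
  (by intro a; ext <;> simp [mul_u, mul_d, one_u, one_d, inv_u, inv_d])

/-- the linear part -/
def uHom : Aff D →* Dˣ where
  toFun := Aff.u
  map_one' := rfl
  map_mul' _ _ := rfl

end Aff

theorem exists_der {α : Type*} (θ : FreeGroup α →* D) (val : α → D) :
    ∃ δ : Der θ, ∀ s, δ.1 (FreeGroup.of s) = val s := by
  let L : FreeGroup α →* Aff D :=
    FreeGroup.lift fun s => ⟨θ.toHomUnits (FreeGroup.of s), val s⟩
  have h1 : Aff.uHom.comp L = θ.toHomUnits := by
    ext s
    simp [L, Aff.uHom]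
  have h2 : ∀ g, ((L g).u : D) = θ g := fun g => by
    have := DFunLike.congr_fun h1 g
    change (L g).u = θ.toHomUnits g at this
    rw [this]; rfl
  refine ⟨⟨fun g => (L g).d, fun g h => ?_⟩, fun s => ?_⟩
  · beta_reduce
    rw [_root_.map_mul, Aff.mul_d, h2]
  · simp [L]

theorem Der.ext_free {α : Type*} {θ : FreeGroup α →* D} (δ : Der θ)
    (h : ∀ s, δ.1 (FreeGroup.of s) = 0) : δ = 0 := by
  have : Der.ker δ = ⊤ := by
    rw [eq_top_iff, ← FreeGroup.closure_range_of, Subgroup.closure_le]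
    rintro _ ⟨s, rfl⟩
    exact h s
  ext g
  have hg : g ∈ Der.ker δ := by rw [this]; trivial
  exact hg

/-- Derivations of a free group. -/
noncomputable def derEquiv {α : Type*} (θ : FreeGroup α →* D) : Der θ ≃ₗ[D] (α → D) :=
  LinearEquiv.ofBijective
    { toFun := fun δ s => δ.1 (FreeGroup.of s)
      map_add' := fun _ _ => rfl
      map_smul' := fun _ _ => rfl }
    ⟨by
      rw [injective_iff_map_eq_zero]
      intro δ h
      exact Der.ext_free δ fun s => congrFun h s, by
      intro val
      obtain ⟨δ, h⟩ := exists_der θ val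
      exact ⟨δ, funext h⟩⟩

theorem finrank_der {n : ℕ} (θ : FreeGroup (Fin n) →* D) : Module.finrank D (Der θ) = n := by
  rw [(derEquiv θ).finrank_eq, Module.finrank_fin_fun]

instance {n : ℕ} (θ : FreeGroup (Fin n) →* D) : Module.Finite D (Der θ) :=
  Module.Finite.equiv (derEquiv θ).symm

/-- pull back -/
def Der.comp {G H : Type*} [Group G] [Group H] (θ : G →* D) (ψ : H →* G) :
    Der θ →ₗ[D] Der (θ.comp ψ) where
  toFun δ := ⟨fun h => δ.1 (ψ h), fun g h => by
    beta_reduce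
    rw [_root_.map_mul, Der.map_mul]; rfl⟩
  map_add' _ _ := rfl
  map_smul' _ _ := rfl

/-- inner derivation -/
def Der.inner {G : Type*} [Group G] (θ : G →* D) : Der θ :=
  ⟨fun g => θ g - 1, fun g h => by beta_reduce; rw [_root_.map_mul]; noncomm_ring⟩

/-- evaluation difference -/
def evalDiff {H₁ H₂ : Type*} [Group H₁] [Group H₂] (θ₁ : H₁ →* D) (θ₂ : H₂ →* D)
    (a b : H₁) (a' b' : H₂) : (Der θ₁ × Der θ₂) →ₗ[D] D × D where
  toFun p := (p.1.1 a - p.2.1 a', p.1.1 b - p.2.1 b')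
  map_add' p q := by ext <;> simp <;> abel
  map_smul' c p := by ext <;> simp [mul_sub]

theorem range_le_one (θ : FreeGroup (Fin 3) →* D)
    (ψ₁ ψ₂ : FreeGroup (Fin 2) →* FreeGroup (Fin 3))
    (hgen : ψ₁.range ⊔ ψ₂.range = ⊤)
    (a b a' b' : FreeGroup (Fin 2)) (ha : ψ₁ a = ψ₂ a') (hb : ψ₁ b = ψ₂ b') :
    Module.finrank D (LinearMap.range (evalDiff (θ.comp ψ₁) (θ.comp ψ₂) a b a' b')) ≤ 1 := by
  set T := evalDiff (θ.comp ψ₁) (θ.comp ψ₂) a b a' b' with hT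
  have h1 := T.finrank_range_add_finrank_ker
  rw [Module.finrank_prod, finrank_der, finrank_der] at h1
  let P : Der θ →ₗ[D] (Der (θ.comp ψ₁) × Der (θ.comp ψ₂)) :=
    (Der.comp θ ψ₁).prod (Der.comp θ ψ₂)
  have hP : ∀ δ, P δ ∈ LinearMap.ker T := by
    intro δ
    rw [LinearMap.mem_ker]
    change (δ.1 (ψ₁ a) - δ.1 (ψ₂ a'), δ.1 (ψ₁ b) - δ.1 (ψ₂ b')) = 0
    rw [ha, hb]; simp
  let P' := P.codRestrict _ hP
  have hinj : Function.Injective P' := by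
    rw [injective_iff_map_eq_zero]
    intro δ hδ
    have h2 : P δ = 0 := congrArg Subtype.val hδ
    have h3 : ∀ g, δ.1 (ψ₁ g) = 0 := fun g =>
      congrFun (congrArg (fun p => p.1.1) h2) g
    have h4 : ∀ g, δ.1 (ψ₂ g) = 0 := fun g =>
      congrFun (congrArg (fun p => p.2.1) h2) g
    have h5 : ψ₁.range ⊔ ψ₂.range ≤ Der.ker δ := by
      refine sup_le ?_ ?_
      · rintro _ ⟨g, rfl⟩; exact h3 g
      · rintro _ ⟨g, rfl⟩; exact h4 g
    rw [hgen] at h5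
    ext g
    exact h5 (Subgroup.mem_top g)
  have h6 := LinearMap.finrank_le_finrank_of_injective hinj
  rw [finrank_der] at h6
  omega

theorem exists_smul_of_finrank_le_one {V : Type*} [AddCommGroup V] [Module D V] [Module.Finite D V]
    (h : Module.finrank D V ≤ 1) {w : V} (hw : w ≠ 0) (u : V) : ∃ v : D, v • w = u := by
  have : Nontrivial V := ⟨w, 0, hw⟩
  have h1 : Module.finrank D V = 1 := le_antisymm h Module.finrank_pos
  exact exists_smul_eq_of_finrank_eq_one h1 hw u

end Der

section Main

variable {Γ : Type*} [Group Γ] [LinearOrder Γ] [MulLeftMono Γ] [MulRightMono Γ]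

/-- finite support subgroup -/
def finSub {G : Type*} [Group G] (ψ : G →* Γ) (δ : Der ((MN.emb (Γ := Γ)).comp ψ)) :
    Subgroup G where
  carrier := {g | (Function.support (δ.1 g).coeff).Finite}
  one_mem' := by
    change (Function.support (δ.1 1).coeff).Finite
    rw [Der.map_one]
    refine Set.finite_empty.subset ?_
    intro a ha; exact ha rfl
  mul_mem' := by
    intro a b ha hb
    change (Function.support (δ.1 (a * b)).coeff).Finite
    rw [Der.map_mul]
    refine ((ha.image (fun t => t * ψ b)).union hb).subset ?_
    intro t ht
    by_contra hcon
    apply ht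
    simp only [Set.mem_union, not_or] at hcon
    have h2 : (δ.1 b).coeff t = 0 := by
      by_contra h; exact hcon.2 h
    have h1 : (δ.1 a).coeff (t * (ψ b)⁻¹) = 0 := by
      by_contra h; exact hcon.1 ⟨_, h, by group⟩
    rw [MN.add_apply, h2, MonoidHom.comp_apply, MN.mul_emb_apply, h1, add_zero]
  inv_mem' := by
    intro a ha
    change (Function.support (δ.1 a⁻¹).coeff).Finite
    rw [Der.map_inv]
    refine (ha.image (fun t => t * ψ a⁻¹)).subset ?_
    intro t ht
    by_contra hcon
    apply ht
    have h1 : (δ.1 a).coeff (t * (ψ a⁻¹)⁻¹) = 0 := by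
      by_contra h; exact hcon ⟨_, h, by group⟩
    rw [MN.neg_apply, MonoidHom.comp_apply, MN.mul_emb_apply, h1, neg_zero]

theorem MN.finsum_sub_one_mul (c : Γ) (f : MN Γ) (hf : (Function.support f.coeff).Finite) :
    ∑ᶠ a, ((MN.emb c - 1) * f).coeff a = 0 := by
  have h1 : ∀ a, ((MN.emb c - 1) * f).coeff a = f.coeff (c⁻¹ * a) - f.coeff a := by
    intro a
    rw [sub_mul, one_mul, MN.sub_apply, MN.emb_mul_apply]
  rw [finsum_congr h1, finsum_sub_distrib _ hf]
  · have := finsum_comp_equiv (Equiv.mulLeft c⁻¹) (f := f.coeff)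
    simp only [Equiv.coe_mulLeft] at this
    rw [this, sub_self]
  · refine (hf.image (fun t => c * t)).subset ?_
    intro t ht
    exact ⟨c⁻¹ * t, ht, by group⟩

theorem MN.support_sub_one_mul (c : Γ) (f : MN Γ) (hf : (Function.support f.coeff).Finite) :
    (Function.support ((MN.emb c - 1) * f).coeff).Finite := by
  refine ((hf.image (fun t => c * t)).union hf).subset ?_
  intro t ht
  by_contra hcon
  apply ht
  simp only [Set.mem_union, not_or] at hcon
  have h2 : f.coeff t = 0 := by
    by_contra h; exact hcon.2 h
  have h1 : f.coeff (c⁻¹ * t) = 0 := by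
    by_contra h; exact hcon.1 ⟨_, h, by group⟩
  rw [sub_mul, one_mul, MN.sub_apply, MN.emb_mul_apply, h1, h2, sub_zero]

theorem commute_of_amalgam [LinearOrder (FreeGroup (Fin 3))] [MulLeftMono (FreeGroup (Fin 3))]
    [MulRightMono (FreeGroup (Fin 3))]
    (ψ₁ ψ₂ : FreeGroup (Fin 2) →* FreeGroup (Fin 3))
    (hgen : ψ₁.range ⊔ ψ₂.range = ⊤)
    (a b a' b' : FreeGroup (Fin 2)) (ha : ψ₁ a = ψ₂ a') (hb : ψ₁ b = ψ₂ b') :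
    Commute (ψ₁ a) (ψ₁ b) := by
  by_contra hcom
  let θ := MN.emb (Γ := FreeGroup (Fin 3))
  have hr := range_le_one θ ψ₁ ψ₂ hgen a b a' b' ha hb
  set T := evalDiff (θ.comp ψ₁) (θ.comp ψ₂) a b a' b' with hT
  have hx1 : MN.emb (ψ₁ a) - 1 ≠ 0 := by
    intro h
    have h1 : ψ₁ a = 1 := MN.emb_injective (by rw [sub_eq_zero.mp h, map_one])
    rw [h1] at hcom
    exact hcom (Commute.one_left _)
  have hT1 : ∀ δ : Der (θ.comp ψ₁), T (δ, 0) = (δ.1 a, δ.1 b) := by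
    intro δ
    change (δ.1 a - 0, δ.1 b - 0) = _
    simp
  have hw : (⟨T (Der.inner (θ.comp ψ₁), 0), LinearMap.mem_range_self _ _⟩ : LinearMap.range T)
      ≠ 0 := by
    intro h
    have h1 := congrArg Subtype.val h
    simp only [hT1] at h1
    exact hx1 (congrArg Prod.fst h1)
  have key : ∀ δ : Der (θ.comp ψ₁), (∀ g, (Function.support (δ.1 g).coeff).Finite) →
      ∃ v : MN (FreeGroup (Fin 3)), (Function.support v.coeff).Finite ∧
        v * (MN.emb (ψ₁ a) - 1) = δ.1 a := by
    intro δ hδ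
    obtain ⟨v, hv⟩ := exists_smul_of_finrank_le_one hr hw
      ⟨T (δ, 0), LinearMap.mem_range_self _ _⟩
    have h1 := congrArg Subtype.val hv
    rw [Submodule.coe_smul] at h1
    simp only [hT1] at h1
    have h2 : v * (MN.emb (ψ₁ a) - 1) = δ.1 a := congrArg Prod.fst h1
    have h3 : v * (MN.emb (ψ₁ b) - 1) = δ.1 b := congrArg Prod.snd h1
    refine ⟨v, MN.support_finite v hcom ?_ ?_, h2⟩
    · rw [h2]; exact hδ _
    · rw [h3]; exact hδ _
  have key2 : ∀ i : Fin 2, ∃ δ : Der (θ.comp ψ₁), (∀ j, δ.1 (FreeGroup.of j) =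
      if j = i then 1 else 0) ∧ ∀ g, (Function.support (δ.1 g).coeff).Finite := by
    intro i
    obtain ⟨δ, hδ⟩ := exists_der (θ.comp ψ₁) (fun j => if j = i then 1 else 0)
    refine ⟨δ, hδ, fun g => ?_⟩
    have : finSub ψ₁ δ = ⊤ := by
      rw [eq_top_iff, ← FreeGroup.closure_range_of, Subgroup.closure_le]
      rintro _ ⟨s, rfl⟩
      change (Function.support (δ.1 (FreeGroup.of s)).coeff).Finite
      rw [hδ]
      refine (Set.finite_singleton 1).subset ?_
      intro t ht
      by_contra hne
      apply ht
      split_ifs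
      · rw [MN.one_def, MN.single_apply]
        exact if_neg hne
      · rfl
    have hg : g ∈ finSub ψ₁ δ := by rw [this]; trivial
    exact hg
  obtain ⟨δc, hc, hcf⟩ := key2 0
  obtain ⟨δd, hd, hdf⟩ := key2 1
  obtain ⟨v, hvf, hv⟩ := key δc hcf
  obtain ⟨w, hwf, hw⟩ := key δd hdf
  set c := MN.emb (ψ₁ (FreeGroup.of 0)) - 1 with hcdef
  set d := MN.emb (ψ₁ (FreeGroup.of 1)) - 1 with hddef
  have hid : Der.inner (θ.comp ψ₁) = c • δc + d • δd := by
    rw [← sub_eq_zero]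
    apply Der.ext_free
    intro s
    change (MN.emb (ψ₁ (FreeGroup.of s)) - 1) - (c * δc.1 (FreeGroup.of s) +
      d * δd.1 (FreeGroup.of s)) = 0
    rw [hc, hd]
    fin_cases s <;> simp [c, d]
  have h1 : MN.emb (ψ₁ a) - 1 = c * δc.1 a + d * δd.1 a :=
    congrFun (congrArg Subtype.val hid) a
  rw [← hv, ← hw, ← mul_assoc, ← mul_assoc, ← add_mul] at h1
  have h2 : 1 = c * v + d * w := by
    have : 1 * (MN.emb (ψ₁ a) - 1) = (c * v + d * w) * (MN.emb (ψ₁ a) - 1) := by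
      rw [one_mul]; exact h1
    exact mul_right_cancel₀ hx1 this
  have h3 : ∑ᶠ t, (1 : MN (FreeGroup (Fin 3))).coeff t = 0 := by
    rw [h2, finsum_congr (fun t => MN.add_apply _ _ t), finsum_add_distrib
      (MN.support_sub_one_mul _ v hvf) (MN.support_sub_one_mul _ w hwf),
      MN.finsum_sub_one_mul _ v hvf, MN.finsum_sub_one_mul _ w hwf, add_zero]
  rw [finsum_eq_single _ 1] at h3
  · simp [MN.one_def, MN.single_apply] at h3
  · intro t ht
    simp [MN.one_def, MN.single_apply, ht]

end Main

end Stmt10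


set_option linter.unusedSectionVars false

namespace Stmt10

section Magnus

variable {α : Type} [DecidableEq α]

/-- left shift -/
def magX (i : α) : (List α → ℤ) →ₗ[ℤ] (List α → ℤ) where
  toFun φ w := match w with
    | [] => 0
    | j :: w => if j = i then φ w else 0
  map_add' φ ψ := by
    funext w
    cases w with
    | nil => simp
    | cons j w => simp only [Pi.add_apply]; split_ifs <;> simp
  map_smul' c φ := by
    funext w
    cases w with
    | nil => simp
    | cons j w => simp

theorem magX_nil (i : α) (φ : List α → ℤ) : magX i φ [] = 0 := rfl
theorem magX_cons (i : α) (φ : List α → ℤ) (j : α) (w : List α) :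
    magX i φ (j :: w) = if j = i then φ w else 0 := rfl

/-- inverse of one plus the left shift. -/
def magY (i : α) (φ : List α → ℤ) : List α → ℤ
  | [] => φ []
  | j :: w => φ (j :: w) - if j = i then magY i φ w else 0

/-- one plus the left shift. -/
def magL (i : α) : (List α → ℤ) ≃ₗ[ℤ] (List α → ℤ) :=
  { (LinearMap.id + magX i : (List α → ℤ) →ₗ[ℤ] (List α → ℤ)) with
    invFun := magY i
    left_inv := by
      intro φ
      funext w
      induction w with
      | nil => simp [magY, magX_nil]
      | cons j w ih =>
        simp only [magY]
        rw [ih]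
        simp [magX_cons]
    right_inv := by
      intro φ
      funext w
      cases w with
      | nil => simp [magY, magX_nil]
      | cons j w => simp [magY, magX_cons] }

theorem magL_apply (i : α) (φ : List α → ℤ) (w : List α) :
    magL i φ w = φ w + magX i φ w := rfl

/-- reversal -/
def magRev : (List α → ℤ) ≃ₗ[ℤ] (List α → ℤ) :=
  LinearEquiv.funCongrLeft ℤ ℤ (Equiv.mk List.reverse List.reverse List.reverse_reverse
    List.reverse_reverse)

theorem magRev_apply (φ : List α → ℤ) (w : List α) : magRev φ w = φ w.reverse := rfl

/-- one plus the right shift. -/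
def magR (i : α) : (List α → ℤ) ≃ₗ[ℤ] (List α → ℤ) := magRev * magL i * magRev

theorem magR_apply (i : α) (φ : List α → ℤ) (w : List α) :
    magR i φ w = φ w + magX i (magRev φ) w.reverse := by
  change magL i (magRev φ) w.reverse = _
  rw [magL_apply, magRev_apply, List.reverse_reverse]

theorem magR_nil (i : α) (φ : List α → ℤ) : magR i φ [] = φ [] := by
  simp [magR_apply, magX_nil]

theorem magR_append (i : α) (φ : List α → ℤ) (j : α) (w : List α) :
    magR i φ (w ++ [j]) = φ (w ++ [j]) + if j = i then φ w else 0 := by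
  rw [magR_apply, List.reverse_append, List.reverse_singleton, List.singleton_append, magX_cons,
    magRev_apply, List.reverse_reverse]

theorem magL_magR (i j : α) : Commute (magL i) (magR j) := by
  ext φ w
  change magL i (magR j φ) w = magR j (magL i φ) w
  rcases List.eq_nil_or_concat w with rfl | ⟨w, l, rfl⟩
  · simp [magL_apply, magR_nil, magX_nil]
  · rw [List.concat_eq_append]
    rw [magR_append, magL_apply, magR_append, magL_apply, magL_apply]
    cases w with
    | nil =>
      have h1 : magR j φ [] = φ [] := magR_nil j φ
      simp only [List.nil_append, magX_cons, magX_nil, h1]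
      split_ifs <;> simp
    | cons k w =>
      rw [List.cons_append, magX_cons, magX_cons, magX_cons, magR_append]
      split_ifs <;> ring

/-- unitriangular -/
def Tri (T : (List α → ℤ) ≃ₗ[ℤ] (List α → ℤ)) : Prop :=
  ∀ φ w, (∀ w' : List α, w'.length < w.length → φ w' = 0) → T φ w = φ w

/-- unitriangular maps -/
def triSub : Subgroup ((List α → ℤ) ≃ₗ[ℤ] (List α → ℤ)) where
  carrier := {T | Tri T}
  one_mem' := fun _ _ _ => rfl
  mul_mem' := by
    intro T S hT hS φ w h
    change T (S φ) w = φ w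
    rw [hT, hS φ w h]
    intro w' hw'
    rw [hS φ w' fun v hv => h v (hv.trans hw'), h w' hw']
  inv_mem' := by
    intro T hT φ w h
    have h1 : T (T⁻¹ φ) = φ := LinearEquiv.apply_symm_apply T φ
    have h2 : ∀ n, ∀ w' : List α, w'.length = n → n < w.length → (T⁻¹ φ) w' = 0 := by
      intro n
      induction n using Nat.strong_induction_on with
      | _ n ih =>
        intro w' hw' hn
        rw [← hT (T⁻¹ φ) w' fun v hv => ih v.length (hw' ▸ hv) v rfl (by omega), h1]
        exact h w' (by omega)
    rw [← hT (T⁻¹ φ) w fun v hv => h2 _ v rfl hv, h1]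

theorem tri_magL (i : α) : magL i ∈ triSub := by
  intro φ w h
  rw [magL_apply]
  cases w with
  | nil => simp [magX_nil]
  | cons j w => simp [magX_cons, h w (by simp)]

theorem tri_magR (i : α) : magR i ∈ triSub := by
  intro φ w h
  rcases List.eq_nil_or_concat w with rfl | ⟨w, l, rfl⟩
  · exact magR_nil i φ
  · rw [List.concat_eq_append, magR_append, h w (by simp)]; simp

/-- the action -/
def magHom : FreeGroup α →* ((List α → ℤ) ≃ₗ[ℤ] (List α → ℤ)) := FreeGroup.lift magL

theorem magHom_tri (g : FreeGroup α) : magHom g ∈ triSub := by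
  have : (⊤ : Subgroup (FreeGroup α)) ≤ triSub.comap magHom := by
    rw [← FreeGroup.closure_range_of, Subgroup.closure_le]
    rintro _ ⟨s, rfl⟩
    simp only [SetLike.mem_coe, Subgroup.mem_comap, magHom, FreeGroup.lift_apply_of]
    exact tri_magL s
  exact this (Subgroup.mem_top g)

theorem magHom_comm (g : FreeGroup α) (i : α) : Commute (magHom g) (magR i) := by
  have : (⊤ : Subgroup (FreeGroup α)) ≤ (Subgroup.centralizer {magR i}).comap magHom := by
    rw [← FreeGroup.closure_range_of, Subgroup.closure_le]
    rintro _ ⟨s, rfl⟩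
    simp only [SetLike.mem_coe, Subgroup.mem_comap, magHom, FreeGroup.lift_apply_of]
    rw [Subgroup.mem_centralizer_singleton_iff]
    exact (magL_magR s i).eq
  have h := this (Subgroup.mem_top g)
  rw [Subgroup.mem_comap, Subgroup.mem_centralizer_singleton_iff] at h
  exact h

/-- the unit series -/
def magOne : List α → ℤ
  | [] => 1
  | _ :: _ => 0

/-- Magnus expansion. -/
def mu (g : FreeGroup α) : List α → ℤ := magHom g magOne

theorem mu_left (g h : FreeGroup α) : mu (g * h) = magHom g (mu h) := by
  rw [mu, map_mul]; rfl

theorem magR_one (i : α) : magR i magOne = magL i magOne := by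
  funext w
  rw [magL_apply]
  rcases List.eq_nil_or_concat w with rfl | ⟨w, l, rfl⟩
  · rw [magR_nil]; simp [magX_nil]
  · rw [List.concat_eq_append, magR_append]
    cases w with
    | nil => simp [magX_cons]
    | cons k w => simp [magX_cons, magOne]; intro; cases w <;> rfl

theorem mu_right (h : FreeGroup α) : ∃ T : (List α → ℤ) ≃ₗ[ℤ] (List α → ℤ), T ∈ triSub ∧
    ∀ g, mu (g * h) = T (mu g) := by
  let S : Subgroup (FreeGroup α) :=
    { carrier := {h | ∃ T : (List α → ℤ) ≃ₗ[ℤ] (List α → ℤ), T ∈ triSub ∧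
        ∀ g, mu (g * h) = T (mu g)}
      one_mem' := ⟨1, Subgroup.one_mem _, fun g => by rw [mul_one]; rfl⟩
      mul_mem' := by
        rintro a b ⟨T, hT, hTg⟩ ⟨U, hU, hUg⟩
        refine ⟨U * T, Subgroup.mul_mem _ hU hT, fun g => ?_⟩
        rw [← mul_assoc, hUg, hTg]; rfl
      inv_mem' := by
        rintro a ⟨T, hT, hTg⟩
        refine ⟨T⁻¹, Subgroup.inv_mem _ hT, fun g => ?_⟩
        have := hTg (g * a⁻¹)
        rw [inv_mul_cancel_right] at this
        rw [this]
        exact (LinearEquiv.symm_apply_apply T _).symm }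
  have : (⊤ : Subgroup (FreeGroup α)) ≤ S := by
    rw [← FreeGroup.closure_range_of, Subgroup.closure_le]
    rintro _ ⟨s, rfl⟩
    refine ⟨magR s, tri_magR s, fun g => ?_⟩
    rw [mu_left]
    have h1 : mu (FreeGroup.of s) = magR s magOne := by
      rw [magR_one, mu, magHom, FreeGroup.lift_apply_of]
    rw [h1]
    exact DFunLike.congr_fun (magHom_comm g s).eq magOne
  exact this (Subgroup.mem_top h)

/-- functions whose top alternating word does not start with `i`. -/
def magB (P : Option α → Prop) (φ : List α → ℤ) : Prop :=
  ∃ n : ℕ, (∀ u : List α, u.IsChain (· ≠ ·) → n < u.length → φ u = 0) ∧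
    ∃ u : List α, u.IsChain (· ≠ ·) ∧ u.length = n ∧ P u.head? ∧ φ u ≠ 0

theorem magL_zpow (i : α) (m : ℤ) (φ : List α → ℤ) (u : List α) :
    u.IsChain (· ≠ ·) → (magL i ^ m) φ u = φ u + m * magX i φ u := by
  have step : ∀ φ : List α → ℤ, ∀ u : List α, u.IsChain (· ≠ ·) →
      magX i (magL i φ) u = magX i φ u := by
    intro φ u hu
    cases u with
    | nil => rfl
    | cons j u =>
      rw [magX_cons, magX_cons]
      split_ifs with h
      · subst h
        rw [magL_apply]
        cases u with
        | nil => simp [magX_nil]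
        | cons k u =>
          have : j ≠ k := by
            rw [List.isChain_cons_cons] at hu; exact hu.1
          rw [magX_cons, if_neg this.symm, add_zero]
      · rfl
  intro hu
  induction m using Int.induction_on generalizing φ with
  | zero => simp
  | succ n ih =>
    rw [zpow_add_one]
    change (magL i ^ (n : ℤ)) (magL i φ) u = _
    rw [ih, step _ _ hu, magL_apply]; ring
  | pred n ih =>
    have h1 : φ = magL i ((magL i)⁻¹ φ) := (LinearEquiv.apply_symm_apply (magL i) φ).symm
    rw [zpow_sub_one]
    change (magL i ^ (-n : ℤ)) ((magL i)⁻¹ φ) u = _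
    rw [ih]
    have h2 : φ u = ((magL i)⁻¹ φ) u + magX i ((magL i)⁻¹ φ) u := by
      conv_lhs => rw [h1]
      rw [magL_apply]
    have h3 : magX i φ u = magX i ((magL i)⁻¹ φ) u := by
      conv_lhs => rw [h1]
      rw [step _ _ hu]
    rw [h2, h3]; ring

theorem magB_step (i : α) (m : ℤ) (hm : m ≠ 0) (φ : List α → ℤ) (h : magB (· ≠ some i) φ) :
    magB (· = some i) ((magL i ^ m) φ) := by
  obtain ⟨n, hn, u, hu, hun, huh, hu0⟩ := h
  refine ⟨n + 1, ?_, i :: u, ?_, by simp [hun], rfl, ?_⟩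
  · intro v hv hvn
    rw [magL_zpow i m φ v hv, hn v hv (by omega)]
    cases v with
    | nil => simp [magX_nil]
    | cons j v =>
      rw [magX_cons, hn v hv.tail (by simpa using hvn)]; simp
  · cases u with
    | nil => simp
    | cons k u =>
      rw [List.isChain_cons_cons]
      refine ⟨?_, hu⟩
      rintro rfl
      exact huh rfl
  · have hc : (i :: u).IsChain (· ≠ ·) := by
      cases u with
      | nil => simp
      | cons k u =>
        rw [List.isChain_cons_cons]
        refine ⟨?_, hu⟩
        rintro rfl
        exact huh rfl
    rw [magL_zpow i m φ _ hc, hn _ hc (by simp [hun]), magX_cons, if_pos rfl, zero_add]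
    exact mul_ne_zero hm hu0

/-- from the free product of copies of the integers -/
def magJ : Monoid.CoprodI (fun _ : α => Multiplicative ℤ) →* FreeGroup α :=
  Monoid.CoprodI.lift fun i => zpowersHom _ (FreeGroup.of i)

theorem magJ_surj : Function.Surjective (magJ (α := α)) := by
  rw [← MonoidHom.range_eq_top, eq_top_iff, ← FreeGroup.closure_range_of, Subgroup.closure_le]
  rintro _ ⟨s, rfl⟩
  exact ⟨Monoid.CoprodI.of (i := s) (Multiplicative.ofAdd 1), by simp [magJ]⟩

theorem magB_neWord {i j : α} (w : Monoid.CoprodI.NeWord (fun _ : α => Multiplicative ℤ) i j) :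
    ∀ φ, magB (· ≠ some j) φ → magB (· = some i) (magHom (magJ w.prod) φ) := by
  induction w with
  | singleton x hx =>
    rename_i i
    intro φ hφ
    have : magHom (magJ (Monoid.CoprodI.NeWord.singleton (M := fun _ : α => Multiplicative ℤ)
        (i := i) x hx).prod) = magL i ^ x.toAdd := by
      simp [magJ, magHom, zpowersHom_apply]
    rw [this]
    refine magB_step i _ ?_ φ hφ
    intro h
    exact hx (Multiplicative.toAdd.injective h)
  | append w₁ hne w₂ ih₁ ih₂ =>
    intro φ hφ
    rw [Monoid.CoprodI.NeWord.append_prod, map_mul, map_mul]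
    refine ih₁ _ ?_
    obtain ⟨n, hn, u, hu, hun, huh, hu0⟩ := ih₂ φ hφ
    refine ⟨n, hn, u, hu, hun, ?_, hu0⟩
    rw [huh]
    intro h
    exact hne (Option.some_injective _ h).symm

theorem mu_eq_one (g : FreeGroup α) (h : mu g = magOne) : g = 1 := by
  classical
  obtain ⟨x, rfl⟩ := magJ_surj g
  by_cases hx : x = 1
  · rw [hx, map_one]
  exfalso
  obtain ⟨i, j, w, hw⟩ := Monoid.CoprodI.NeWord.of_word (Monoid.CoprodI.Word.equiv x) (by
    intro h'
    apply hx
    have h2 := Monoid.CoprodI.Word.equiv.symm_apply_apply x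
    rw [h'] at h2
    rw [← h2]
    exact Monoid.CoprodI.Word.prod_empty)
  have hwx : w.prod = x := by
    rw [Monoid.CoprodI.NeWord.prod, hw]
    exact Monoid.CoprodI.Word.equiv.symm_apply_apply x
  have h1 := magB_neWord w magOne ⟨0, by
      intro u _ hu
      cases u with
      | nil => simp at hu
      | cons => rfl, [], by simp, rfl, by simp, by simp [magOne]⟩
  rw [hwx] at h1
  obtain ⟨n, -, u, -, -, huh, hu0⟩ := h1
  have h2 : magHom (magJ x) magOne = magOne := h
  rw [h2] at hu0
  cases u with
  | nil => simp at huh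
  | cons => exact hu0 rfl

theorem mu_injective : Function.Injective (mu (α := α)) := by
  intro a b hab
  have h1 : mu (a⁻¹ * b) = magOne := by
    rw [mu_left, ← hab, ← mu_left, inv_mul_cancel, mu, map_one]; rfl
  exact (inv_mul_eq_one.mp (mu_eq_one _ h1))

/-- words, ordered by length first -/
structure Wd where
  w : List (Fin 3)

/-- the key -/
def Wd.key (u : Wd) : ℕ ×ₗ ℕ := toLex (u.w.length, Encodable.encode u.w)

theorem Wd.key_injective : Function.Injective Wd.key := by
  rintro ⟨u⟩ ⟨v⟩ h
  have : Encodable.encode u = Encodable.encode v := congrArg (fun p => (ofLex p).2) h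
  rw [Encodable.encode_injective this]

noncomputable instance : LinearOrder Wd := LinearOrder.lift' Wd.key Wd.key_injective

instance : WellFoundedLT Wd := ⟨InvImage.wf Wd.key wellFounded_lt⟩

theorem Wd.lt_of_length {u v : Wd} (h : u.w.length < v.w.length) : u < v := by
  change Wd.key u < Wd.key v
  rw [Wd.key, Wd.key, Prod.Lex.toLex_lt_toLex]
  exact Or.inl h

theorem Wd.length_le {u v : Wd} (h : u ≤ v) : u.w.length ≤ v.w.length := by
  by_contra h'
  push Not at h'
  exact absurd h (not_le.mpr (Wd.lt_of_length h'))

/-- comparison map -/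
def muLex (φ : List (Fin 3) → ℤ) : Lex (Wd → ℤ) := toLex fun u => φ u.w

theorem muLex_injective : Function.Injective muLex := by
  intro φ ψ h
  funext w
  exact congrFun (congrArg ofLex h) ⟨w⟩

theorem muLex_lt {T : (List (Fin 3) → ℤ) ≃ₗ[ℤ] (List (Fin 3) → ℤ)} (hT : T ∈ triSub)
    {φ ψ : List (Fin 3) → ℤ} (h : muLex φ < muLex ψ) : muLex (T φ) < muLex (T ψ) := by
  obtain ⟨i, hi, hlt⟩ := h
  have hi : ∀ j : Wd, j < i → φ j.w = ψ j.w := hi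
  have hlt : φ i.w < ψ i.w := hlt
  have key : ∀ j : Wd, j ≤ i → T (ψ - φ) j.w = ψ j.w - φ j.w := by
    intro j hj
    rw [hT (ψ - φ) j.w]
    · rfl
    · intro w' hw'
      have : (⟨w'⟩ : Wd) < i := lt_of_lt_of_le (Wd.lt_of_length hw') hj
      have := hi _ this
      simp only [Pi.sub_apply]
      linarith
  refine ⟨i, fun j hj => ?_, ?_⟩
  · have h1 := key j hj.le
    rw [map_sub, Pi.sub_apply, hi j hj, sub_self] at h1
    change T φ j.w = T ψ j.w
    linarith
  · have h1 := key i le_rfl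
    rw [map_sub, Pi.sub_apply] at h1
    change T φ i.w < T ψ i.w
    linarith

/-- the bi-order on the free group. -/
noncomputable instance fgOrder : LinearOrder (FreeGroup (Fin 3)) :=
  LinearOrder.lift' (fun g => muLex (mu g)) (muLex_injective.comp mu_injective)

instance : MulLeftMono (FreeGroup (Fin 3)) := ⟨by
  intro c a b hab
  rcases eq_or_lt_of_le hab with h | h
  · rw [h]
  · apply le_of_lt
    change muLex (mu (c * a)) < muLex (mu (c * b))
    rw [mu_left, mu_left]
    exact muLex_lt (magHom_tri c) h⟩

instance : MulRightMono (FreeGroup (Fin 3)) := ⟨by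
  intro c a b hab
  rcases eq_or_lt_of_le hab with h | h
  · rw [h]
  · apply le_of_lt
    change muLex (mu (a * c)) < muLex (mu (b * c))
    obtain ⟨T, hT, hTg⟩ := mu_right c
    rw [hTg, hTg]
    exact muLex_lt hT h⟩

end Magnus

end Stmt10


set_option linter.unusedSectionVars false

namespace Stmt10

section Hopf

variable {α : Type} [DecidableEq α]

/-- words of bounded length -/
abbrev TrW (α : Type) (n : ℕ) : Type := {w : List α // w.length ≤ n}

/-- truncated Magnus action, modulo `N` -/
def truncFun (n N : ℕ) (i : α) (φ : TrW α n → ZMod N) : TrW α n → ZMod N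
  | ⟨[], h⟩ => φ ⟨[], h⟩
  | ⟨j :: w, h⟩ => φ ⟨j :: w, h⟩ + if j = i then φ ⟨w, (Nat.le_succ _).trans h⟩ else 0

theorem truncFun_injective (n N : ℕ) (i : α) : Function.Injective (truncFun n N i) := by
  intro φ ψ h
  funext ⟨w, hw⟩
  induction w with
  | nil => exact congrFun h ⟨[], hw⟩
  | cons j w ih =>
    have h1 := congrFun h ⟨j :: w, hw⟩
    simp only [truncFun] at h1
    rw [ih] at h1
    exact add_right_cancel h1

instance [Finite α] (n : ℕ) : Finite (TrW α n) := (List.finite_length_le α n).to_subtype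

/-- truncated Magnus permutation -/
noncomputable def truncPerm [Finite α] (n N : ℕ) [NeZero N] (i : α) :
    Equiv.Perm (TrW α n → ZMod N) :=
  Equiv.ofBijective (truncFun n N i) (Finite.injective_iff_bijective.mp (truncFun_injective n N i))

/-- restriction -/
def truncRes (n N : ℕ) (φ : List α → ℤ) : TrW α n → ZMod N := fun w => (φ w.1 : ZMod N)

theorem truncRes_magL [Finite α] (n N : ℕ) [NeZero N] (i : α) (φ : List α → ℤ) :
    truncRes n N (magL i φ) = truncPerm n N i (truncRes n N φ) := by
  funext ⟨w, hw⟩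
  change ((magL i φ w : ℤ) : ZMod N) = truncFun n N i (truncRes n N φ) ⟨w, hw⟩
  cases w with
  | nil => simp [magL_apply, magX_nil, truncFun, truncRes]
  | cons j w =>
    simp only [magL_apply, magX_cons, truncFun, truncRes]
    split_ifs <;> simp

theorem truncRes_magHom [Finite α] (n N : ℕ) [NeZero N] (g : FreeGroup α) :
    ∀ φ : List α → ℤ, truncRes n N (magHom g φ) =
      FreeGroup.lift (truncPerm n N) g (truncRes n N φ) := by
  induction g using FreeGroup.induction_on with
  | C1 => intro φ; simp
  | of s => intro φ; simp [magHom, truncRes_magL]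
  | inv_of s ih =>
    intro φ
    rw [map_inv, map_inv, Equiv.Perm.eq_inv_iff_eq, ← ih]
    congr 1
    exact LinearEquiv.apply_symm_apply (magHom (FreeGroup.of s)) φ
  | mul a b iha ihb =>
    intro φ
    rw [map_mul, map_mul, LinearEquiv.mul_apply, iha, ihb, Equiv.Perm.mul_apply]

theorem residually_finite [Finite α] (g : FreeGroup α) (hg : g ≠ 1) :
    ∃ (Q : Type) (_ : Group Q) (_ : Finite Q) (ρ : FreeGroup α →* Q), ρ g ≠ 1 := by
  have h1 : mu g ≠ magOne := fun h => hg (mu_eq_one g h)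
  obtain ⟨w, hw⟩ := Function.ne_iff.mp h1
  let N : ℕ := (mu g w - magOne w).natAbs + 1
  have : NeZero N := ⟨Nat.succ_ne_zero _⟩
  refine ⟨Equiv.Perm (TrW α w.length → ZMod N), inferInstance, inferInstance,
    FreeGroup.lift (truncPerm w.length N), fun h => ?_⟩
  have h2 := truncRes_magHom w.length N g magOne
  rw [h] at h2
  have h3 : ((mu g w : ℤ) : ZMod N) = ((magOne w : ℤ) : ZMod N) := congrFun h2 ⟨w, le_rfl⟩
  have h4 : (((mu g w - magOne w : ℤ)) : ZMod N) = 0 := by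
    rw [Int.cast_sub, h3, sub_self]
  rw [ZMod.intCast_zmod_eq_zero_iff_dvd] at h4
  have h5 := Int.natAbs_dvd_natAbs.mpr h4
  have h6 := Nat.le_of_dvd (Int.natAbs_pos.mpr (sub_ne_zero.mpr hw)) h5
  simp only [Int.natAbs_natCast, N] at h6
  omega

theorem hopfian [Finite α] (f : FreeGroup α →* FreeGroup α) (hf : Function.Surjective f) :
    Function.Injective f := by
  rw [injective_iff_map_eq_one]
  intro g hg
  by_contra hne
  obtain ⟨Q, _, _, ρ, hρ⟩ := residually_finite g hne
  have : Finite (FreeGroup α →* Q) := Finite.of_equiv _ FreeGroup.lift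
  have hinj : Function.Injective (fun σ : FreeGroup α →* Q => σ.comp f) := by
    intro σ τ h
    ext s
    obtain ⟨x, hx⟩ := hf (FreeGroup.of s)
    rw [← hx]
    exact DFunLike.congr_fun h x
  obtain ⟨σ, hσ⟩ := Finite.surjective_of_injective hinj ρ
  apply hρ
  rw [← hσ]
  change σ (f g) = 1
  rw [hg, map_one]

/-- the test group -/
abbrev Z2 : Type := Multiplicative (ZMod 2)

theorem inj_or_card (A : Type) [Group A] [IsFreeGroup A] (p : FreeGroup (Fin 2) →* A)
    (hp : Function.Surjective p) :
    Function.Injective p ∨ (Finite (A →* Z2) ∧ Nat.card (A →* Z2) ≤ 2) := by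
  classical
  have hinj : Function.Injective (fun σ : A →* Z2 => σ.comp p) := by
    intro σ τ h
    ext s
    obtain ⟨x, rfl⟩ := hp s
    exact DFunLike.congr_fun h x
  have hfin2 : Finite (FreeGroup (Fin 2) →* Z2) := Finite.of_equiv _ FreeGroup.lift
  have hfin : Finite (A →* Z2) := Finite.of_injective _ hinj
  have hcard : Nat.card (A →* Z2) ≤ 4 := by
    refine (Nat.card_le_card_of_injective _ hinj).trans ?_
    rw [← Nat.card_congr (FreeGroup.lift (α := Fin 2) (β := Z2))]
    simp [Nat.card_eq_fintype_card, ZMod.card]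
  let Y := IsFreeGroup.Generators A
  let e : A ≃* FreeGroup Y := IsFreeGroup.toFreeGroup A
  let E : (Y → Z2) ≃ (A →* Z2) := FreeGroup.lift.trans (e.symm.monoidHomCongrLeftEquiv)
  have hfinY : Finite (Y → Z2) := Finite.of_equiv _ E.symm
  have : Finite Y := by
    refine Finite.of_injective (fun y : Y => (Pi.mulSingle y (Multiplicative.ofAdd 1) : Y → Z2)) ?_
    intro a b hab
    by_contra hne
    have := congrFun hab a
    simp only [Pi.mulSingle_eq_same, Pi.mulSingle_eq_of_ne hne] at this
    exact absurd this (by decide)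
  have hc : Nat.card (A →* Z2) = 2 ^ Nat.card Y := by
    rw [← Nat.card_congr E, Nat.card_fun]
    simp [Nat.card_eq_fintype_card, ZMod.card]
  rw [hc] at hcard ⊢
  have h2 : Nat.card Y ≤ 2 := by
    by_contra h
    push Not at h
    have : 2 ^ 3 ≤ 2 ^ Nat.card Y := Nat.pow_le_pow_right (by norm_num) h
    omega
  by_cases h3 : Nat.card Y = 2
  · left
    let c : Y ≃ Fin 2 := Finite.equivFinOfCardEq h3
    let e' : A ≃* FreeGroup (Fin 2) := e.trans (FreeGroup.freeGroupCongr c)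
    have := hopfian (e'.toMonoidHom.comp p) (e'.surjective.comp hp)
    exact Function.Injective.of_comp (f := e') this
  · right
    refine ⟨hfin, ?_⟩
    have : 2 ^ Nat.card Y ≤ 2 ^ 1 := Nat.pow_le_pow_right (by norm_num) (by omega)
    simpa using this

theorem exists_inj (ψ₁ ψ₂ : FreeGroup (Fin 2) →* FreeGroup (Fin 3))
    (hgen : ψ₁.range ⊔ ψ₂.range = ⊤) : Function.Injective ψ₁ ∨ Function.Injective ψ₂ := by
  rcases inj_or_card ψ₁.range ψ₁.rangeRestrict ψ₁.rangeRestrict_surjective with h1 | ⟨f1, h1⟩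
  · left
    exact Subtype.val_injective.comp h1
  rcases inj_or_card ψ₂.range ψ₂.rangeRestrict ψ₂.rangeRestrict_surjective with h2 | ⟨f2, h2⟩
  · right
    exact Subtype.val_injective.comp h2
  exfalso
  let r : (FreeGroup (Fin 3) →* Z2) → (ψ₁.range →* Z2) × (ψ₂.range →* Z2) :=
    fun σ => (σ.comp ψ₁.range.subtype, σ.comp ψ₂.range.subtype)
  have hr : Function.Injective r := by
    intro σ τ h
    have h3 : ψ₁.range ⊔ ψ₂.range ≤ MonoidHom.eqLocus σ τ := by
      refine sup_le ?_ ?_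
      · intro x hx
        exact DFunLike.congr_fun (congrArg Prod.fst h) ⟨x, hx⟩
      · intro x hx
        exact DFunLike.congr_fun (congrArg Prod.snd h) ⟨x, hx⟩
    rw [hgen] at h3
    ext s
    exact congrArg _ (h3 (Subgroup.mem_top (FreeGroup.of s)))
  have h4 := Nat.card_le_card_of_injective r hr
  rw [Nat.card_prod, ← Nat.card_congr (FreeGroup.lift (α := Fin 3) (β := Z2))] at h4
  have h5 : Nat.card (Fin 3 → Z2) = 8 := by
    simp [Nat.card_eq_fintype_card, ZMod.card]
  rw [h5] at h4
  nlinarith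

end Hopf

theorem isCyclic_of_comm_of_free (A : Type*) [Group A] [IsFreeGroup A]
    (h : ∀ a b : A, a * b = b * a) : IsCyclic A := by
  classical
  let Y := IsFreeGroup.Generators A
  let e : A ≃* FreeGroup Y := IsFreeGroup.toFreeGroup A
  have hcomm : ∀ a b : FreeGroup Y, a * b = b * a := by
    intro a b
    apply e.symm.injective
    rw [map_mul, map_mul, h]
  have hsub : ∀ x y : Y, x = y := by
    intro x y
    by_contra hne
    let σ : FreeGroup Y →* Equiv.Perm (Fin 3) :=
      FreeGroup.lift fun z => if z = x then Equiv.swap 0 1 else Equiv.swap 1 2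
    have h1 := congrArg σ (hcomm (FreeGroup.of x) (FreeGroup.of y))
    simp only [σ, map_mul, FreeGroup.lift_apply_of, if_true, if_neg (Ne.symm hne)] at h1
    exact absurd h1 (by decide)
  have hcyc : IsCyclic (FreeGroup Y) := by
    by_cases hY : Nonempty Y
    · obtain ⟨y⟩ := hY
      refine ⟨FreeGroup.of y, fun x => ?_⟩
      have : (⊤ : Subgroup (FreeGroup Y)) ≤ Subgroup.zpowers (FreeGroup.of y) := by
        rw [← FreeGroup.closure_range_of, Subgroup.closure_le]
        rintro _ ⟨s, rfl⟩
        rw [hsub s y]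
        exact Subgroup.mem_zpowers _
      exact this (Subgroup.mem_top x)
    · rw [not_nonempty_iff] at hY
      infer_instance
  exact isCyclic_of_surjective e.symm e.symm.surjective

theorem main (M : Type*) [Group M]
    (φ : ∀ _ : Bool, M →* FreeGroup (Fin 2))
    (hinj : ∀ i, Function.Injective (φ i))
    (hsurj : ∃ f : Monoid.PushoutI φ →* FreeGroup (Fin 3), Function.Surjective f) :
    IsCyclic M := by
  obtain ⟨f, hf⟩ := hsurj
  let ψ : Bool → FreeGroup (Fin 2) →* FreeGroup (Fin 3) :=
    fun i => f.comp (Monoid.PushoutI.of (φ := φ) i)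
  have hψ : ∀ i m, ψ i (φ i m) = f (Monoid.PushoutI.base φ m) := by
    intro i m
    change f (Monoid.PushoutI.of (φ := φ) i (φ i m)) = _
    rw [Monoid.PushoutI.of_apply_eq_base]
  have hgen : (ψ true).range ⊔ (ψ false).range = ⊤ := by
    rw [eq_top_iff]
    intro x _
    obtain ⟨y, rfl⟩ := hf x
    have hof : ∀ i g, f (Monoid.PushoutI.of (φ := φ) i g) ∈ (ψ true).range ⊔ (ψ false).range := by
      intro i g
      cases i
      · exact Subgroup.mem_sup_right ⟨g, rfl⟩
      · exact Subgroup.mem_sup_left ⟨g, rfl⟩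
    induction y using Monoid.PushoutI.induction_on with
    | of i g => exact hof i g
    | base m =>
      rw [← Monoid.PushoutI.of_apply_eq_base φ true]
      exact hof _ _
    | mul a b ha hb =>
      rw [map_mul]
      exact Subgroup.mul_mem _ (ha trivial) (hb trivial)
  have hbase : ∀ m m', Commute (f (Monoid.PushoutI.base φ m)) (f (Monoid.PushoutI.base φ m')) := by
    intro m m'
    rw [← hψ true m, ← hψ true m']
    exact commute_of_amalgam (ψ true) (ψ false) hgen _ _ (φ false m) (φ false m')
      (by rw [hψ, hψ]) (by rw [hψ, hψ])
  have hbinj : Function.Injective (fun m => f (Monoid.PushoutI.base φ m)) := by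
    rcases exists_inj (ψ true) (ψ false) hgen with h | h
    · intro a b hab
      refine hinj true (h ?_)
      rw [hψ, hψ]; exact hab
    · intro a b hab
      refine hinj false (h ?_)
      rw [hψ, hψ]; exact hab
  have hcomm : ∀ a b : M, a * b = b * a := by
    intro a b
    apply hbinj
    change f (Monoid.PushoutI.base φ (a * b)) = f (Monoid.PushoutI.base φ (b * a))
    rw [map_mul, map_mul, map_mul, map_mul]
    exact (hbase a b).eq
  let e : M ≃* (φ true).range := MonoidHom.ofInjective (hinj true)
  have hc : IsCyclic (φ true).range := by
    apply isCyclic_of_comm_of_free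
    intro a b
    apply e.symm.injective
    rw [map_mul, map_mul, hcomm]
  exact isCyclic_of_surjective e.symm e.symm.surjective

end Stmt10

/-- If `G = H₁ *_M H₂` is an amalgamated free product of two free groups of rank 2 over a
common subgroup `M` (given by injective homomorphisms `M → H₁`, `M → H₂`), and `G`
surjects onto the free group of rank 3, then `M` is cyclic (possibly trivial). -/
theorem stmt10 (M : Type*) [Group M]
    (φ : ∀ _ : Bool, M →* FreeGroup (Fin 2))
    (hinj : ∀ i, Function.Injective (φ i))
    (hsurj : ∃ f : Monoid.PushoutI φ →* FreeGroup (Fin 3), Function.Surjective f) :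
    IsCyclic M := by
  exact Stmt10.main M φ hinj hsurj
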